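/- There is no function u : ℝ → ℝ and constant c₀ > 0 with all of the following properties: u is twice continuously differentiable; u has compact support; u(x) ≥ 0 for all x; u(x) > 0 for all x in some open neighborhood of 0; −x·u'(x) ≥ 0 for all x ∈ ℝ; and |x·u''(x)| ≤ c₀·|u'(x)| for all x ≠ 0. -/

import Mathlib

noncomputable section
open Real Set

/-- **Condition (F) of Combes–Hislop–Mourre is never satisfied** (Appendix B,
one-dimensional case): there is no nonnegative `C²` compactly supported
function `u`, positive near `0`, with `-x u'(x) ≥ 0` everywhere and
`|x u''(x)| ≤ c₀ |u'(x)|` away from `0`. -/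
theorem no_CHM_single_site :
    ¬ ∃ (u : ℝ → ℝ) (c₀ : ℝ), 0 < c₀ ∧
      ContDiff ℝ 2 u ∧ HasCompactSupport u ∧
      (∀ x, 0 ≤ u x) ∧
      (∃ ε > (0:ℝ), ∀ x : ℝ, |x| < ε → 0 < u x) ∧
      (∀ x : ℝ, 0 ≤ -x * deriv u x) ∧
      (∀ x : ℝ, x ≠ 0 → |x * deriv (deriv u) x| ≤ c₀ * |deriv u x|) := by
  rintro ⟨u, c, hc, hu, hs, -, ⟨ε, hε, hpos⟩, h1, h2⟩
  have hd : Differentiable ℝ u := hu.differentiable (by norm_num)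
  have hu' : ContDiff ℝ 1 (deriv u) := by
    have h : ContDiff ℝ (1 + 1) u := by
      convert hu using 1
      norm_num
    exact (contDiff_succ_iff_deriv.1 h).2.2
  have hd' : Differentiable ℝ (deriv u) := hu'.differentiable (by norm_num)
  obtain ⟨R, hR, hR0⟩ := hs.exists_pos_le_norm
  obtain ⟨S, hS, hS0⟩ := hs.deriv.exists_pos_le_norm
  have hneg : ∀ x : ℝ, 0 < x → deriv u x ≤ 0 := by
    intro x hx
    have := h1 x
    by_contra! h
    nlinarith [mul_pos hx h]
  have hder : ∀ x : ℝ, 0 < x → HasDerivAt (fun y => y ^ c * deriv u y)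
      (c * x ^ (c - 1) * deriv u x + x ^ c * deriv (deriv u) x) x := by
    intro x hx
    exact (Real.hasDerivAt_rpow_const (Or.inl hx.ne')).mul (hd' x).hasDerivAt
  have hanti : AntitoneOn (fun y : ℝ => y ^ c * deriv u y) (Ioi 0) := by
    apply antitoneOn_of_deriv_nonpos (convex_Ioi 0)
    · intro x hx
      exact (hder x hx).continuousAt.continuousWithinAt
    · intro x hx
      rw [interior_Ioi] at hx
      exact (hder x hx).differentiableAt.differentiableWithinAt
    · intro x hx
      rw [interior_Ioi] at hx
      have hx0 : 0 < x := hx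
      rw [(hder x hx).deriv]
      have e : x ^ c = x ^ (c - 1) * x := by
        rw [Real.rpow_sub_one hx0.ne']
        field_simp
      have h3 := h2 x hx0.ne'
      rw [abs_of_nonpos (hneg x hx0)] at h3
      have h4 := (le_abs_self _).trans h3
      have h5 : 0 < x ^ (c - 1) := Real.rpow_pos_of_pos hx0 _
      rw [e]
      have : c * deriv u x + x * deriv (deriv u) x ≤ 0 := by linarith
      nlinarith [mul_nonneg h5.le (neg_nonneg.2 this)]
  have hzero : ∀ x : ℝ, 0 < x → deriv u x = 0 := by
    intro x hx
    apply le_antisymm (hneg x hx)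
    have h3 : 0 < max x S := lt_max_of_lt_left hx
    have h4 := hanti hx h3 (le_max_left x S)
    have h5 : deriv u (max x S) = 0 := by
      apply hS0
      rw [Real.norm_eq_abs, abs_of_pos h3]
      exact le_max_right _ _
    simp only [h5, mul_zero] at h4
    exact nonneg_of_mul_nonneg_right h4 (Real.rpow_pos_of_pos hx c)
  have hT : 0 < max (ε / 2) R := lt_max_of_lt_right hR
  have hconst := constant_of_has_deriv_right_zero (f := u) (a := ε / 2) (b := max (ε / 2) R)
    hd.continuous.continuousOn (by
      intro x hx
      have := (hd x).hasDerivAt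
      rw [hzero x (by linarith [hx.1])] at this
      exact this.hasDerivWithinAt) _ (right_mem_Icc.2 (le_max_left _ _))
  have h6 : u (max (ε / 2) R) = 0 := by
    apply hR0
    rw [Real.norm_eq_abs, abs_of_pos hT]
    exact le_max_right _ _
  have h7 := hpos (ε / 2) (by rw [abs_of_pos (by linarith)]; linarith)
  linarith
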